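/- arXiv:2602.03746 — 2 statements merged into one kernel-verified Lean document; each statement's English description precedes it below -/
import Mathlib

section
/- Let x be an infinite word over a finite alphabet that is P-power-free for some integer P ≥ 1 and is generated by a congenial sequence (τ_n, a_n)_{n≥0} (so x = x^{(0)} is infinite) satisfying: (i) there exists k ∈ ℕ such that τ_{n,n+k} is positive for all n ≥ 0; (ii) each τ_n is decisive in x^{(n+1)}; (iii) there exists K > 0 such that |τ_n| ≤ K and #A_n ≤ K for all n ≥ 0, and |τ_{0,n}(a)| ≤ K·|τ_{0,n}(b)| for all n ≥ 1 and all a, b ∈ A_n. Suppose there exists a sequence (B_n)_{n≥0} of positive reals such that x^{(n)} is B_n-letter-balanced for every n ≥ 0. Then x is factor-balanced. Moreover, if the sequence (B_n)_{n≥0} is bounded, then x is uniformly factor-balanced. -/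
open scoped Classical

section Core

variable {A : Type*} {B : Type*}

/-- `w` occurs at position `i` of the infinite word `x`. -/
def OccursAt (x : ℕ → A) (w : List A) (i : ℕ) : Prop :=
  w = (List.range w.length).map fun j => x (i + j)

/-- `w` is a factor of the infinite word `x`. -/
def IsFactor (x : ℕ → A) (w : List A) : Prop := ∃ i, OccursAt x w i

/-- The number of (possibly overlapping) occurrences of `w` in the finite word `u`,
i.e. `|u|_w`. -/
noncomputable def countOccs (u w : List A) : ℕ :=
  ((Finset.range (u.length + 1)).filter fun i => w <+: u.drop i).card

/-- The finite word `w` is `C`-balanced in the infinite word `x`. -/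
def BalancedIn (C : ℝ) (w : List A) (x : ℕ → A) : Prop :=
  ∀ u v : List A, IsFactor x u → IsFactor x v → u.length = v.length →
    |(countOccs u w : ℝ) - (countOccs v w : ℝ)| ≤ C

/-- Every finite word is `C_w`-balanced in `x` for some constant `C_w > 0`. -/
def FactorBalanced (x : ℕ → A) : Prop :=
  ∀ w : List A, ∃ C : ℝ, 0 < C ∧ BalancedIn C w x

/-- There is a single constant `C > 0` such that every finite word is `C`-balanced in `x`. -/
def UniformlyFactorBalanced (x : ℕ → A) : Prop :=
  ∃ C : ℝ, 0 < C ∧ ∀ w : List A, BalancedIn C w x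

/-- Every letter is `C`-balanced in `x`. -/
def LetterBalanced (C : ℝ) (x : ℕ → A) : Prop :=
  ∀ a : A, BalancedIn C [a] x

/-- `x` is `P`-power-free: no factor of `x` is a `P`-th power of a nonempty word. -/
def PowerFree (P : ℕ) (x : ℕ → A) : Prop :=
  ∀ v : List A, v ≠ [] → ¬ IsFactor x (List.flatten (List.replicate P v))

/-- The length-`n` prefix of the infinite word `x`. -/
def wordPrefix (x : ℕ → A) (n : ℕ) : List A := (List.range n).map x

/-- The extension of a substitution to finite words. -/
def substWord (τ : A → List B) (w : List A) : List B := (w.map τ).flatten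

/-- The word `w` has (prefix) frequency `μ` in `x`. -/
def HasFreq (x : ℕ → A) (w : List A) (μ : ℝ) : Prop :=
  Filter.Tendsto (fun n => (countOccs (wordPrefix x n) w : ℝ) / n)
    Filter.atTop (nhds μ)

/-- `τ` is `k`-decisive in `x` with witness map `r` (each `r a` of length `k ≥ 1`,
and `τ b` starts with `r a` whenever `ab` is a factor of `x`). -/
def DecisiveWith (τ : A → List B) (x : ℕ → A) (r : A → List B) (k : ℕ) : Prop :=
  1 ≤ k ∧ (∀ a, (r a).length = k) ∧
    ∀ a b : A, IsFactor x [a, b] → r a <+: τ b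

/-- `τ` is `k`-decisive in `x`. -/
def Decisive (τ : A → List B) (x : ℕ → A) (k : ℕ) : Prop :=
  ∃ r : A → List B, DecisiveWith τ x r k

/-- The image of the infinite word `x` under the substitution `τ`: when the images of
prefixes of `x` have unbounded length, `substInf τ x` is the infinite word `τ(x)`. -/
noncomputable def substInf [Nonempty B] (τ : A → List B) (x : ℕ → A) (j : ℕ) : B :=
  if h : ∃ n, j < (substWord τ (wordPrefix x n)).length
  then (substWord τ (wordPrefix x (Nat.find h))).get ⟨j, Nat.find_spec h⟩
  else Classical.arbitrary B

/-- Iterates of a substitution: `substIter τ n a = τ^n(a)` as a finite word. -/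
def substIter (τ : A → List A) : ℕ → A → List A
  | 0, a => [a]
  | n+1, a => substWord (substIter τ n) (τ a)

/-- `τ` is prolongable on the letter `a`. -/
def Prolongable (τ : A → List A) (a : A) : Prop :=
  (τ a).head? = some a ∧ (∀ b, τ b ≠ []) ∧
    Filter.Tendsto (fun n => (substIter τ n a).length) Filter.atTop Filter.atTop

/-- The fixed point `τ^ω(a)` of a substitution prolongable on `a`:
the limit of the prefix chain `τ^n(a)`. -/
noncomputable def fixedPoint (τ : A → List A) (a : A) (j : ℕ) : A :=
  if h : ∃ n, j < (substIter τ n a).length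
  then (substIter τ (Nat.find h) a).get ⟨j, Nat.find_spec h⟩
  else a

/-- The factor complexity of `x`: the number of distinct length-`n` factors. -/
noncomputable def complexity (x : ℕ → A) (n : ℕ) : ℕ :=
  Set.ncard {w : List A | w.length = n ∧ IsFactor x w}

/-- Every factor of `x` occurs infinitely often in `x`. -/
def Recurrent (x : ℕ → A) : Prop :=
  ∀ w : List A, IsFactor x w → ∀ N : ℕ, ∃ i, N ≤ i ∧ OccursAt x w i

/-- For every factor `w` of `x` there is `k` such that `w` occurs in
every length-`k` factor of `x`. -/
def UniformlyRecurrent (x : ℕ → A) : Prop :=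
  ∀ w : List A, IsFactor x w → ∃ k : ℕ, ∀ v : List A, IsFactor x v →
    v.length = k → 1 ≤ countOccs v w

end Core

section Congenial

variable {A : ℕ → Type*}

/-- `compSubst τ m k : A (m+k) → List (A m)` is `τ_{m,m+k} = τ_m ∘ τ_{m+1} ∘ ⋯ ∘ τ_{m+k-1}`
(and the identity for `k = 0`). -/
def compSubst (τ : ∀ n, A (n+1) → List (A n)) (m : ℕ) :
    (k : ℕ) → A (m + k) → List (A m)
  | 0, a => [a]
  | k+1, a => ((τ (m + k) a).map (compSubst τ m k)).flatten

/-- `limitWord τ s m` is the infinite word `x^{(m)}`: the limit of the words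
`τ_{m,m+k}(s (m+k))`, which form a chain of prefixes when the sequence is congenial. -/
noncomputable def limitWord (τ : ∀ n, A (n+1) → List (A n)) (s : ∀ n, A n)
    (m : ℕ) (j : ℕ) : A m :=
  if h : ∃ k, j < (compSubst τ m k (s (m + k))).length
  then (compSubst τ m (Nat.find h) (s (m + Nat.find h))).get ⟨j, Nat.find_spec h⟩
  else s m

end Congenial

section InfiniteWords

variable {A : Type*} {B : Type*}

theorem occursAt_iff_getElem {x : ℕ → A} {w : List A} {i : ℕ} :
    OccursAt x w i ↔ ∀ (t : ℕ) (h : t < w.length), w[t] = x (i + t) := by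
  unfold OccursAt
  constructor
  · intro h t ht
    have := List.getElem_of_eq h ht
    simpa using this
  · intro h
    apply List.ext_getElem
    · simp
    · intro t h1 h2
      simpa using h t h1

theorem occursAt_map_range (x : ℕ → A) (i n : ℕ) :
    OccursAt x ((List.range n).map fun j => x (i + j)) i := by
  simp [OccursAt]

theorem occursAt_append {x : ℕ → A} {u v : List A} {i : ℕ} :
    OccursAt x (u ++ v) i ↔ OccursAt x u i ∧ OccursAt x v (i + u.length) := by
  have h : ((List.range (u ++ v).length).map fun j => x (i + j)) =
      ((List.range u.length).map fun j => x (i + j)) ++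
        ((List.range v.length).map fun j => x (i + u.length + j)) := by
    rw [List.length_append, List.range_add, List.map_append, List.map_map]
    congr 1
    apply List.map_congr_left
    intro j _
    simp [add_assoc]
  unfold OccursAt
  rw [h]
  constructor
  · intro h
    exact List.append_inj h (by simp)
  · rintro ⟨h1, h2⟩
    exact congrArg₂ (· ++ ·) h1 h2

theorem OccursAt.of_isPrefix_word {x : ℕ → A} {u v : List A} {i : ℕ}
    (hv : OccursAt x v i) (h : u <+: v) : OccursAt x u i := by
  obtain ⟨t, rfl⟩ := h
  exact (occursAt_append.1 hv).1

theorem OccursAt.drop {x : ℕ → A} {v : List A} {i : ℕ}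
    (hv : OccursAt x v i) {t : ℕ} (ht : t ≤ v.length) : OccursAt x (v.drop t) (i + t) := by
  rw [← List.take_append_drop t v] at hv
  have := (occursAt_append.1 hv).2
  rwa [List.length_take, min_eq_left ht] at this

theorem OccursAt.prefix_of_length_le {x : ℕ → A} {u v : List A} {i : ℕ}
    (hv : OccursAt x v i) (hu : OccursAt x u i) (h : u.length ≤ v.length) : u <+: v := by
  rw [List.prefix_iff_getElem]
  refine ⟨h, fun t ht => ?_⟩
  rw [occursAt_iff_getElem.1 hv, occursAt_iff_getElem.1 hu]

theorem OccursAt.isPrefix_drop_iff {x : ℕ → A} {w v : List A} {i t : ℕ}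
    (hv : OccursAt x v i) (ht : t ≤ v.length) :
    w <+: v.drop t ↔ t + w.length ≤ v.length ∧ OccursAt x w (i + t) := by
  constructor
  · intro h
    have := h.length_le
    rw [List.length_drop] at this
    exact ⟨by omega, (hv.drop ht).of_isPrefix_word h⟩
  · rintro ⟨h1, h2⟩
    exact (hv.drop ht).prefix_of_length_le h2 (by rw [List.length_drop]; omega)

theorem countOccs_eq_count {x : ℕ → A} {u w : List A} {i : ℕ} (hu : OccursAt x u i) :
    countOccs u w =
      Nat.count (fun t => OccursAt x w (i + t)) (u.length + 1 - w.length) := by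
  rw [Nat.count_eq_card_filter_range]
  unfold countOccs
  congr 1
  ext t
  simp only [Finset.mem_filter, Finset.mem_range]
  constructor
  · rintro ⟨h1, h2⟩
    have := (hu.isPrefix_drop_iff (by omega)).1 h2
    exact ⟨by omega, this.2⟩
  · rintro ⟨h1, h2⟩
    exact ⟨by omega, (hu.isPrefix_drop_iff (by omega)).2 ⟨by omega, h2⟩⟩

/-- Two occurrences of `w` in a `P`-power-free word are at distance at least `|w| / P`. -/
theorem PowerFree.length_le_mul {x : ℕ → A} {P : ℕ} (hpf : PowerFree P x) {w : List A}
    {a d : ℕ} (hd : 0 < d) (h1 : OccursAt x w a) (h2 : OccursAt x w (a + d)) :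
    w.length ≤ P * d := by
  by_contra! hlt
  set v := (List.range d).map fun j => x (a + j) with hv
  have hvl : v.length = d := by simp [hv]
  have key : ∀ q : ℕ, q * d ≤ w.length → OccursAt x (List.replicate q v).flatten a := by
    intro q
    induction q with
    | zero => intro _; simp [OccursAt]
    | succ q ih =>
      intro hq
      have hq' : q * d ≤ w.length := le_trans (Nat.mul_le_mul_right d q.le_succ) hq
      rw [List.replicate_succ, List.flatten_cons, occursAt_append]
      refine ⟨occursAt_map_range x a d, ?_⟩
      rw [hvl]
      exact h2.of_isPrefix_word (h1.prefix_of_length_le (ih hq') (by simpa [hvl] using hq'))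
  refine hpf v ?_ ⟨a, key P hlt.le⟩
  intro h
  simp [h] at hvl
  omega

theorem PowerFree.count_le {x : ℕ → A} {P : ℕ} (hpf : PowerFree P x) {w : List A}
    (hw : w ≠ []) {a b : ℕ} {T : ℝ} (hT : 0 ≤ T) (hab : (b : ℝ) ≤ a + T) :
    (Nat.count (OccursAt x w) b : ℝ) ≤
      Nat.count (OccursAt x w) a + P * T / w.length + 1 := by
  have hl : 0 < w.length := List.length_pos_iff.2 hw
  have hl' : (0 : ℝ) < w.length := by exact_mod_cast hl
  have hnn : 0 ≤ P * T / w.length := by positivity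
  rcases le_total b a with h | h
  · have : (Nat.count (OccursAt x w) b : ℝ) ≤ Nat.count (OccursAt x w) a := by
      exact_mod_cast Nat.count_monotone _ h
    linarith
  · obtain ⟨c, rfl⟩ := Nat.exists_eq_add_of_le h
    have hcard : Nat.count (fun k => OccursAt x w (a + k)) c ≤ P * c / w.length + 1 := by
      rw [Nat.count_eq_card_filter_range, ← Finset.card_range (P * c / w.length + 1)]
      apply Finset.card_le_card_of_injOn (fun t => P * t / w.length)
      · intro t ht
        have ht' : t < c := by simpa using (Finset.mem_filter.1 ht).1
        simp only [Finset.coe_range, Set.mem_Iio, Nat.lt_succ_iff]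
        exact Nat.div_le_div_right (Nat.mul_le_mul_left P ht'.le)
      · have hlt : ∀ t t' : ℕ, t < t' → OccursAt x w (a + t) → OccursAt x w (a + t') →
            P * t / w.length < P * t' / w.length := by
          intro t t' htt h1 h2
          obtain ⟨d, rfl⟩ := Nat.exists_eq_add_of_lt htt
          have := hpf.length_le_mul (d := d + 1) (by omega) h1
            (by simpa only [add_assoc] using h2)
          calc P * t / w.length < P * t / w.length + 1 := Nat.lt_succ_self _
            _ = (P * t + w.length) / w.length := (Nat.add_div_right _ hl).symm
            _ ≤ P * (t + d + 1) / w.length := Nat.div_le_div_right (by linarith)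
        intro t ht t' ht' heq
        have h1 := (Finset.mem_filter.1 ht).2
        have h2 := (Finset.mem_filter.1 ht').2
        rcases lt_trichotomy t t' with h | h | h
        · exact absurd heq (hlt t t' h h1 h2).ne
        · exact h
        · exact absurd heq (hlt t' t h h2 h1).ne'
    have hcT : (c : ℝ) ≤ T := by push_cast at hab; linarith
    have h2 : ((P * c / w.length : ℕ) : ℝ) ≤ P * T / w.length := by
      calc ((P * c / w.length : ℕ) : ℝ) ≤ ((P * c : ℕ) : ℝ) / w.length := Nat.cast_div_le
        _ ≤ P * T / w.length := by push_cast; gcongr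
    have h3 : (Nat.count (fun k => OccursAt x w (a + k)) c : ℝ) ≤
        (P * c / w.length : ℕ) + 1 := by exact_mod_cast hcard
    rw [Nat.count_add]
    push_cast
    linarith

theorem LetterBalanced.abs_sum_sub_sum_le [Fintype B] {β : ℝ} {y : ℕ → B}
    (hy : LetterBalanced β y) (hβ : 0 ≤ β) {f : B → ℝ} {F : ℝ} (hF : 0 ≤ F)
    (hf : ∀ i, |f (y i)| ≤ F) (j j' n : ℕ) :
    |∑ i ∈ Finset.range n, f (y (j + i)) - ∑ i ∈ Finset.range n, f (y (j' + i))| ≤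
      Fintype.card B * β * F := by
  have hocc : ∀ (a : B) (i : ℕ), OccursAt y [a] i ↔ y i = a := by
    intro a i
    simp [OccursAt, eq_comm]
  have hsum : ∀ j, ∑ i ∈ Finset.range n, f (y (j + i)) =
      ∑ a : B, f a * (Nat.count (fun t => OccursAt y [a] (j + t)) n : ℝ) := by
    intro j
    have h : ∀ a : B, f a * (Nat.count (fun t => OccursAt y [a] (j + t)) n : ℝ) =
        ∑ i ∈ Finset.range n, if y (j + i) = a then f a else 0 := by
      intro a
      rw [Nat.count_eq_card_filter_range, ← Finset.sum_filter, Finset.sum_const,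
        nsmul_eq_mul, mul_comm]
      simp only [hocc]
    simp_rw [h]
    rw [Finset.sum_comm]
    simp
  rw [hsum, hsum, ← Finset.sum_sub_distrib]
  refine (Finset.abs_sum_le_sum_abs _ _).trans ?_
  calc _ ≤ ∑ _a : B, β * F := Finset.sum_le_sum fun a _ => ?_
    _ = Fintype.card B * β * F := by
      rw [Finset.sum_const, Finset.card_univ, nsmul_eq_mul, mul_assoc]
  rw [← mul_sub, abs_mul, mul_comm β F]
  by_cases ha : ∃ i, y i = a
  · obtain ⟨i, rfl⟩ := ha
    refine mul_le_mul (hf i) ?_ (abs_nonneg _) hF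
    have := hy (y i) _ _ ⟨j, occursAt_map_range y j n⟩ ⟨j', occursAt_map_range y j' n⟩ (by simp)
    rw [countOccs_eq_count (occursAt_map_range y j n),
      countOccs_eq_count (occursAt_map_range y j' n)] at this
    simpa using this
  · push Not at ha
    have h0 : ∀ j, Nat.count (fun t => OccursAt y [a] (j + t)) n = 0 := by
      intro j
      rw [Nat.count_eq_card_filter_range]
      simp [hocc, ha]
    simp only [h0, sub_self, abs_zero, mul_zero]
    positivity

theorem wordPrefix_succ (y : ℕ → B) (j : ℕ) :
    wordPrefix y (j + 1) = wordPrefix y j ++ [y j] := by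
  simp [wordPrefix, List.range_succ]

theorem substWord_append (σ : B → List A) (u v : List B) :
    substWord σ (u ++ v) = substWord σ u ++ substWord σ v := by
  simp [substWord]

/-- The position in `σ(y)` at which the image of the `j`-th letter of `y` starts. -/
def blockStart (σ : B → List A) (y : ℕ → B) (j : ℕ) : ℕ :=
  (substWord σ (wordPrefix y j)).length

theorem blockStart_succ (σ : B → List A) (y : ℕ → B) (j : ℕ) :
    blockStart σ y (j + 1) = blockStart σ y j + (σ (y j)).length := by
  simp [blockStart, wordPrefix_succ, substWord]

theorem blockStart_add (σ : B → List A) (y : ℕ → B) (j n : ℕ) :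
    blockStart σ y (j + n) =
      blockStart σ y j + ∑ i ∈ Finset.range n, (σ (y (j + i))).length := by
  induction n with
  | zero => simp
  | succ n ih => rw [← add_assoc, blockStart_succ, ih, Finset.sum_range_succ, add_assoc]

theorem exists_blockStart_le {σ : B → List A} (hσ : ∀ b, 0 < (σ b).length) (y : ℕ → B)
    (i : ℕ) : ∃ j, blockStart σ y j ≤ i ∧ i < blockStart σ y (j + 1) := by
  induction i with
  | zero =>
    refine ⟨0, by simp [blockStart, wordPrefix, substWord], ?_⟩
    rw [blockStart_succ]
    exact Nat.lt_add_left _ (hσ _)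
  | succ i ih =>
    obtain ⟨j, h1, h2⟩ := ih
    rcases Nat.lt_or_ge (i + 1) (blockStart σ y (j + 1)) with h | h
    · exact ⟨j, by omega, h⟩
    · refine ⟨j + 1, h, ?_⟩
      rw [blockStart_succ]
      have := hσ (y (j + 1))
      omega

/-- If `x = σ(y)` and the image of each letter of `y` is followed by a long enough word
depending on that letter only, then so is the number of occurrences of `w` that start in
this image. -/
theorem exists_count_blockStart_add {x : ℕ → A} {y : ℕ → B} {σ R : B → List A}
    (hx : ∀ j, OccursAt x (substWord σ (wordPrefix y j)) 0) {w : List A}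
    (hR : ∀ b, w.length ≤ (R b).length) (hRσ : ∀ j, R (y j) <+: σ (y (j + 1))) :
    ∃ N : B → ℕ, ∀ j n, Nat.count (OccursAt x w) (blockStart σ y (j + n)) =
      Nat.count (OccursAt x w) (blockStart σ y j) + ∑ i ∈ Finset.range n, N (y (j + i)) := by
  have hblock : ∀ j, OccursAt x (σ (y j)) (blockStart σ y j) := by
    intro j
    have := hx (j + 1)
    rw [wordPrefix_succ, substWord_append, occursAt_append] at this
    simpa [substWord, blockStart] using this.2
  have hblock' : ∀ j, OccursAt x (σ (y j) ++ R (y j)) (blockStart σ y j) := by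
    intro j
    rw [occursAt_append, ← blockStart_succ]
    exact ⟨hblock j, (hblock (j + 1)).of_isPrefix_word (hRσ j)⟩
  refine ⟨fun b => Nat.count (fun t => w <+: (σ b ++ R b).drop t) (σ b).length, ?_⟩
  intro j n
  induction n with
  | zero => simp
  | succ n ih =>
    rw [Finset.sum_range_succ, ← add_assoc j, blockStart_succ, Nat.count_add, ih, add_assoc]
    congr 2
    beta_reduce
    rw [Nat.count_eq_card_filter_range, Nat.count_eq_card_filter_range]
    congr 1
    apply Finset.filter_congr
    intro t ht
    rw [Finset.mem_range] at ht
    have := hR (y (j + n))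
    rw [(hblock' (j + n)).isPrefix_drop_iff (by rw [List.length_append]; omega),
      List.length_append, and_iff_right (by omega)]

theorem balancedIn_of_letterBalanced [Fintype B] {x : ℕ → A} {y : ℕ → B} {σ R : B → List A}
    (hx : ∀ j, OccursAt x (substWord σ (wordPrefix y j)) 0) (hσ : ∀ b, 0 < (σ b).length)
    {w : List A} (hw : w ≠ []) (hR : ∀ b, w.length ≤ (R b).length)
    (hRσ : ∀ j, R (y j) <+: σ (y (j + 1))) {P : ℕ} (hpf : PowerFree P x)
    {β Q K : ℝ} (hβ : 0 ≤ β) (hQ : 0 ≤ Q) (hK : Fintype.card B ≤ K)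
    (hσQ : ∀ b, ((σ b).length : ℝ) ≤ Q * w.length) (hy : LetterBalanced β y) :
    BalancedIn (2 * (P * Q + 1) + (P * Q * (2 + K * β) + 1) + K * β * (P * Q + 1)) w x := by
  obtain ⟨N, hN⟩ := exists_count_blockStart_add hx hR hRσ
  set S := Nat.count (OccursAt x w) with hS
  set p := blockStart σ y with hp
  have hl : (0 : ℝ) < w.length := by exact_mod_cast List.length_pos_iff.2 hw
  have hK0 : 0 ≤ K := le_trans (Nat.cast_nonneg _) hK
  have hwin : ∀ (a b : ℕ) (q : ℝ), 0 ≤ q → (b : ℝ) ≤ a + q * w.length →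
      (S b : ℝ) ≤ S a + (P * q + 1) := by
    intro a b q hq hab
    have := hpf.count_le hw (T := q * w.length) (by positivity) hab
    rw [← mul_assoc, mul_div_cancel_right₀ _ hl.ne'] at this
    linarith
  have hmono : ∀ {a b : ℕ}, a ≤ b → (S a : ℝ) ≤ S b := by
    intro a b hab
    exact_mod_cast Nat.count_monotone _ hab
  have hNle : ∀ i, |(N (y i) : ℝ)| ≤ P * Q + 1 := by
    intro i
    have h1 := hN i 1
    have h2 := hwin (p i) (p (i + 1)) Q hQ (by
      rw [hp, blockStart_succ]; push_cast; linarith [hσQ (y i)])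
    rw [h1] at h2
    simp only [Finset.range_one, Finset.sum_singleton, add_zero] at h2
    push_cast at h2
    rw [abs_of_nonneg (Nat.cast_nonneg _)]
    linarith
  have hcardβ : ∀ F : ℝ, 0 ≤ F → Fintype.card B * β * F ≤ K * β * F := by
    intro F hF
    gcongr
  have hblock : ∀ i, ∃ j, p j ≤ i ∧ (i : ℝ) ≤ p j + Q * w.length := by
    intro i
    obtain ⟨j, h1, h2⟩ := exists_blockStart_le hσ y i
    refine ⟨j, h1, ?_⟩
    rw [blockStart_succ] at h2
    have h3 : (i : ℝ) ≤ p j + (σ (y j)).length := by exact_mod_cast h2.le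
    linarith [hσQ (y j)]
  have main : ∀ i i' L : ℕ, (S (i + L) : ℝ) - S i ≤ S (i' + L) - S i' +
      (2 * (P * Q + 1) + (P * Q * (2 + K * β) + 1) + K * β * (P * Q + 1)) := by
    intro i i' L
    obtain ⟨j, hj1, hj2⟩ := hblock i
    obtain ⟨J, hJ1, hJ2⟩ := hblock (i + L)
    obtain ⟨j', hj1', hj2'⟩ := hblock i'
    obtain ⟨J', hJ1', hJ2'⟩ := hblock (i' + L)
    have hpm : ∀ a n, p a ≤ p (a + n) := by
      intro a n
      rw [hp, blockStart_add]
      exact Nat.le_add_right _ _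
    obtain ⟨D, hD1, hD2⟩ : ∃ D, (p J' : ℝ) ≤ p (j' + D) ∧ p (j' + D) ≤ i' + L := by
      rcases le_or_gt j' J' with h | h
      · obtain ⟨D, rfl⟩ := Nat.exists_eq_add_of_le h
        exact ⟨D, le_rfl, hJ1'⟩
      · refine ⟨0, ?_, by rw [add_zero]; omega⟩
        obtain ⟨D, rfl⟩ := Nat.exists_eq_add_of_le h.le
        exact_mod_cast hpm J' D
    have hlen := hy.abs_sum_sub_sum_le hβ (f := fun b => ((σ b).length : ℝ))
      (F := Q * w.length) (by positivity)
      (fun i => by rw [abs_of_nonneg (Nat.cast_nonneg _)]; exact hσQ _) j j' D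
    have hcnt := hy.abs_sum_sub_sum_le hβ (f := fun b => (N b : ℝ))
      (F := P * Q + 1) (by positivity) hNle j j' D
    have hlen' := (abs_le.1 (hlen.trans (hcardβ _ (by positivity)))).1
    have hcnt' := (abs_le.1 (hcnt.trans (hcardβ _ (by positivity)))).2
    have e1 : (p (j + D) : ℝ) = p j + ∑ i ∈ Finset.range D, ((σ (y (j + i))).length : ℝ) := by
      rw [hp, blockStart_add]; push_cast; rfl
    have e2 : (p (j' + D) : ℝ) =
        p j' + ∑ i ∈ Finset.range D, ((σ (y (j' + i))).length : ℝ) := by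
      rw [hp, blockStart_add]; push_cast; rfl
    have e3 : (S (p (j + D)) : ℝ) = S (p j) + ∑ i ∈ Finset.range D, (N (y (j + i)) : ℝ) := by
      rw [hN]; push_cast; rfl
    have e4 : (S (p (j' + D)) : ℝ) =
        S (p j') + ∑ i ∈ Finset.range D, (N (y (j' + i)) : ℝ) := by
      rw [hN]; push_cast; rfl
    have s1 := hwin (p J) (i + L) Q hQ hJ2
    have s2 := hwin (p j') i' Q hQ hj2'
    have hJ1r : (p J : ℝ) ≤ i + L := by exact_mod_cast hJ1
    have hj1r' : (p j' : ℝ) ≤ i' := by exact_mod_cast hj1'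
    push_cast at hJ2'
    have s3 := hwin (p (j + D)) (p J) (Q * (2 + K * β)) (by positivity) (by
      have : Q * (2 + K * β) * w.length =
        2 * (Q * w.length) + K * β * (Q * w.length) := by ring
      linarith)
    have s4 := hmono hj1
    have s5 := hmono hD2
    rw [← mul_assoc] at s3
    linarith
  rintro u v ⟨i, hu⟩ ⟨i', hv⟩ huv
  have hcu := countOccs_eq_count (w := w) hu
  have hcv := countOccs_eq_count (w := w) hv
  rw [← huv] at hcv
  set L := u.length + 1 - w.length
  have e1 : (S (i + L) : ℝ) = S i + countOccs u w := by
    rw [hcu, hS, Nat.count_add]; push_cast; rfl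
  have e2 : (S (i' + L) : ℝ) = S i' + countOccs v w := by
    rw [hcv, hS, Nat.count_add]; push_cast; rfl
  have h1 := main i i' L
  have h2 := main i' i L
  rw [abs_le]
  constructor <;> linarith

theorem BalancedIn.mono {C C' : ℝ} {w : List A} {x : ℕ → A} (h : BalancedIn C w x)
    (hC : C ≤ C') : BalancedIn C' w x :=
  fun u v hu hv huv => (h u v hu hv huv).trans hC

theorem balancedIn_nil {C : ℝ} (hC : 0 ≤ C) (x : ℕ → A) : BalancedIn C [] x := by
  intro u v _ _ huv
  simpa [countOccs, huv] using hC

theorem length_substWord_le {σ : B → List A} {C : ℕ} (hC : ∀ b, (σ b).length ≤ C)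
    (u : List B) : (substWord σ u).length ≤ C * u.length := by
  induction u with
  | nil => simp [substWord]
  | cons b u ih =>
    have := hC b
    have h : substWord σ (b :: u) = σ b ++ substWord σ u := by simp [substWord]
    rw [h, List.length_append, List.length_cons, mul_add]
    omega

end InfiniteWords

section Congenial

variable {A : ℕ → Type*}

theorem compSubst_succ (τ : ∀ n, A (n+1) → List (A n)) (m k : ℕ) (a : A (m + (k + 1))) :
    compSubst τ m (k + 1) a = substWord (compSubst τ m k) (τ (m + k) a) := rfl

theorem subst_cast (τ : ∀ n, A (n+1) → List (A n)) {p q : ℕ} (h : p = q) (a : A (p + 1)) :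
    τ q (cast (congrArg (fun i => A (i + 1)) h) a) = (τ p a).map (cast (congrArg A h)) := by
  subst h
  exact (List.map_id _).symm

theorem compSubst_add (τ : ∀ n, A (n+1) → List (A n)) (m n k : ℕ) (a : A (m + (n + k))) :
    compSubst τ m (n + k) a = substWord (compSubst τ m n)
      (compSubst τ (m + n) k (cast (congrArg A (Nat.add_assoc m n k).symm) a)) := by
  induction k with
  | zero => simp [compSubst, substWord]
  | succ k ih =>
    have h := subst_cast τ (Nat.add_assoc m n k).symm a
    change substWord (compSubst τ m (n + k)) (τ (m + (n + k)) a) =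
      substWord (compSubst τ m n) (substWord (compSubst τ (m + n) k) (τ (m + n + k)
        (cast (congrArg (fun i => A (i + 1)) (Nat.add_assoc m n k).symm) a)))
    rw [h]
    generalize τ (m + (n + k)) a = u
    induction u with
    | nil => simp [substWord]
    | cons b u ihu =>
      simp only [substWord, List.map_cons, List.flatten_cons, List.map_append,
        List.flatten_append] at ihu ⊢
      rw [ihu, ih]
      rfl

theorem cast_letter (s : ∀ n, A n) {p q : ℕ} (h : p = q) :
    cast (congrArg A h) (s p) = s q := by
  subst h
  rfl

variable {τ : ∀ n, A (n+1) → List (A n)} {s : ∀ n, A n}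

theorem compSubst_isPrefix_of_le (hcong : ∀ n, (τ n (s (n+1))).head? = some (s n)) (m : ℕ)
    {k k' : ℕ} (h : k ≤ k') :
    compSubst τ m k (s (m + k)) <+: compSubst τ m k' (s (m + k')) := by
  induction k', h using Nat.le_induction with
  | base => exact List.prefix_rfl
  | succ j _ ih =>
    refine ih.trans ?_
    obtain ⟨u, hu⟩ := List.head?_eq_some_iff.1 (hcong (m + j))
    change _ <+: substWord (compSubst τ m j) (τ (m + j) (s (m + j + 1)))
    rw [hu]
    simp [substWord]

theorem occursAt_limitWord (hcong : ∀ n, (τ n (s (n+1))).head? = some (s n)) (m k : ℕ) :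
    OccursAt (limitWord τ s m) (compSubst τ m k (s (m + k))) 0 := by
  rw [occursAt_iff_getElem]
  intro t ht
  have hex : ∃ k, t < (compSubst τ m k (s (m + k))).length := ⟨k, ht⟩
  rw [zero_add, limitWord, dif_pos hex, List.get_eq_getElem]
  exact ((compSubst_isPrefix_of_le hcong m (Nat.find_min' hex ht)).getElem (Nat.find_spec hex)).symm

theorem occursAt_limitWord_substWord [∀ n, Fintype (A n)]
    (hcong : ∀ n, (τ n (s (n+1))).head? = some (s n))
    {m : ℕ} (hinf : ∀ N : ℕ, ∃ k, N ≤ (compSubst τ m k (s (m + k))).length) (n j : ℕ) :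
    OccursAt (limitWord τ s m)
      (substWord (compSubst τ m n) (wordPrefix (limitWord τ s (m + n)) j)) 0 := by
  have hs : ∀ k, compSubst τ m (n + k) (s (m + (n + k))) =
      substWord (compSubst τ m n) (compSubst τ (m + n) k (s (m + n + k))) := by
    intro k
    rw [compSubst_add, cast_letter s (Nat.add_assoc m n k).symm]
  obtain ⟨C, hC⟩ : ∃ C, ∀ b : A (m + n), (compSubst τ m n b).length ≤ C :=
    ⟨_, fun b => Finset.le_sup (f := fun b => (compSubst τ m n b).length) (Finset.mem_univ b)⟩
  obtain ⟨k, hk⟩ := hinf (C * j + 1)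
  have h1 := (compSubst_isPrefix_of_le hcong m (Nat.le_add_left k n)).length_le
  have h2 := length_substWord_le hC (compSubst τ (m + n) k (s (m + n + k)))
  rw [hs] at h1
  have hj : j ≤ (compSubst τ (m + n) k (s (m + n + k))).length :=
    (Nat.lt_of_mul_lt_mul_left (a := C) (by omega)).le
  have hpre : wordPrefix (limitWord τ s (m + n)) j <+:
      compSubst τ (m + n) k (s (m + n + k)) := by
    apply (occursAt_limitWord hcong (m + n) k).prefix_of_length_le
    · simp [OccursAt, wordPrefix]
    · simpa [wordPrefix] using hj
  obtain ⟨u, hu⟩ := hpre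
  have := occursAt_limitWord hcong m (n + k)
  rw [hs, ← hu, substWord_append] at this
  exact (occursAt_append.1 this).1

theorem length_compSubst_pos (hcong : ∀ n, (τ n (s (n+1))).head? = some (s n)) {K : ℝ}
    (hquasi : ∀ n, 1 ≤ n → ∀ a b : A (0 + n),
      ((compSubst τ 0 n a).length : ℝ) ≤ K * ((compSubst τ 0 n b).length : ℝ))
    (n : ℕ) (b : A (0 + n)) : 0 < (compSubst τ 0 n b).length := by
  have hs : 1 ≤ (compSubst τ 0 n (s (0 + n))).length := by
    simpa [compSubst] using (compSubst_isPrefix_of_le hcong 0 (Nat.zero_le n)).length_le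
  rcases Nat.eq_zero_or_pos n with rfl | hn
  · simp [compSubst]
  · rw [Nat.pos_iff_ne_zero]
    intro h0
    have := hquasi n hn (s (0 + n)) b
    rw [h0, Nat.cast_zero, mul_zero] at this
    have h1 : (1 : ℝ) ≤ (compSubst τ 0 n (s (0 + n))).length := by exact_mod_cast hs
    linarith

theorem length_compSubst_succ_le {K C : ℝ} (hC : 0 ≤ C)
    (hlen : ∀ n, ∀ b : A (n+1), ((τ n b).length : ℝ) ≤ K) {m n : ℕ}
    (h : ∀ b : A (m + n), ((compSubst τ m n b).length : ℝ) ≤ C) (b : A (m + (n + 1))) :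
    ((compSubst τ m (n + 1) b).length : ℝ) ≤ K * C := by
  have h1 := length_substWord_le (σ := compSubst τ m n) (C := ⌊C⌋₊)
    (fun b => Nat.le_floor (h b)) (τ (m + n) b)
  rw [← compSubst_succ] at h1
  calc ((compSubst τ m (n + 1) b).length : ℝ)
      ≤ (⌊C⌋₊ : ℝ) * (τ (m + n) b).length := by exact_mod_cast h1
    _ ≤ C * K := by
        gcongr
        · exact Nat.floor_le hC
        · exact hlen _ b
    _ = K * C := mul_comm _ _

/-- There is a level `n` at which all images are at least as long as `ℓ`, while those of the
next level are at most `K ^ 3` times longer. -/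
theorem exists_level
    (hinfinite : ∀ N : ℕ, ∃ k, N ≤ (compSubst τ 0 k (s (0 + k))).length)
    {K : ℝ} (hK : 1 ≤ K) (hlen : ∀ n, ∀ b : A (n+1), ((τ n b).length : ℝ) ≤ K)
    (hquasi : ∀ n, 1 ≤ n → ∀ a b : A (0 + n),
      ((compSubst τ 0 n a).length : ℝ) ≤ K * ((compSubst τ 0 n b).length : ℝ))
    {ℓ : ℕ} (hℓ : 1 ≤ ℓ) :
    ∃ n, (∀ b : A (0 + n), ℓ ≤ (compSubst τ 0 n b).length) ∧
      ∀ b : A (0 + (n + 1)), ((compSubst τ 0 (n + 1) b).length : ℝ) ≤ K ^ 3 * ℓ := by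
  have hquasi' : ∀ n, ∀ a b : A (0 + n),
      ((compSubst τ 0 n a).length : ℝ) ≤ K * ((compSubst τ 0 n b).length : ℝ) := by
    intro n a b
    rcases Nat.eq_zero_or_pos n with rfl | hn
    · simpa [compSubst] using hK
    · exact hquasi n hn a b
  have hℓ' : (1 : ℝ) ≤ ℓ := by exact_mod_cast hℓ
  have hex : ∃ n, ∀ b : A (0 + n), ℓ ≤ (compSubst τ 0 n b).length := by
    obtain ⟨N, hN⟩ := exists_nat_ge (K * ℓ)
    obtain ⟨n, hn⟩ := hinfinite N
    refine ⟨n, fun b => ?_⟩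
    have h1 : (N : ℝ) ≤ (compSubst τ 0 n (s (0 + n))).length := by exact_mod_cast hn
    have h2 : K * ℓ ≤ K * (compSubst τ 0 n b).length :=
      (hN.trans h1).trans (hquasi' n _ b)
    exact_mod_cast le_of_mul_le_mul_left h2 (by linarith)
  refine ⟨Nat.find hex, Nat.find_spec hex, ?_⟩
  have hmin : ∀ m, m < Nat.find hex → ¬ ∀ b : A (0 + m), ℓ ≤ (compSubst τ 0 m b).length :=
    fun m => Nat.find_min hex
  generalize Nat.find hex = n at hmin
  have hK2 : K ^ 3 * ℓ = K * (K * (K * ℓ)) := by ring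
  have hKℓ : (1 : ℝ) ≤ K * ℓ := one_le_mul_of_one_le_of_one_le hK hℓ'
  rw [hK2]
  apply length_compSubst_succ_le (by positivity) hlen
  cases n with
  | zero =>
    intro b
    simpa [compSubst] using one_le_mul_of_one_le_of_one_le hK hKℓ
  | succ m =>
    apply length_compSubst_succ_le (by positivity) hlen
    have := hmin m (Nat.lt_succ_self m)
    push Not at this
    obtain ⟨b, hb⟩ := this
    intro a
    refine (hquasi' m a b).trans ?_
    gcongr

theorem exists_balancedIn_limitWord [∀ n, Fintype (A n)]
    (hcong : ∀ n, (τ n (s (n+1))).head? = some (s n))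
    (hinfinite : ∀ N : ℕ, ∃ k, N ≤ (compSubst τ 0 k (s (0 + k))).length)
    {P : ℕ} (hpf : PowerFree P (limitWord τ s 0))
    {K : ℝ} (hK : 1 ≤ K) (hlen : ∀ n, ∀ b : A (n+1), ((τ n b).length : ℝ) ≤ K)
    (hcard : ∀ n, (Fintype.card (A n) : ℝ) ≤ K)
    (hquasi : ∀ n, 1 ≤ n → ∀ a b : A (0 + n),
      ((compSubst τ 0 n a).length : ℝ) ≤ K * ((compSubst τ 0 n b).length : ℝ))
    (hdec : ∀ n, ∃ d, Decisive (τ n) (limitWord τ s (n + 1)) d)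
    {Bn : ℕ → ℝ} (hBpos : ∀ n, 0 < Bn n)
    (hbal : ∀ n, LetterBalanced (Bn n) (limitWord τ s n)) (w : List (A 0)) :
    ∃ n, BalancedIn (2 * (P * K ^ 3 + 1) + (P * K ^ 3 * (2 + K * Bn n) + 1) +
      K * Bn n * (P * K ^ 3 + 1)) w (limitWord τ s 0) := by
  have hK0 : 0 < K := by linarith
  by_cases hw : w = []
  · subst hw
    have := hBpos 0
    exact ⟨0, balancedIn_nil (by positivity) _⟩
  obtain ⟨n, hn1, hn2⟩ := exists_level hinfinite hK hlen hquasi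
    (List.length_pos_iff.2 hw)
  obtain ⟨d, r, hd, hr, hrτ⟩ := hdec (0 + n)
  have hrne : ∀ a, r a ≠ [] := by
    intro a ha
    have := hr a
    simp [ha] at this
    omega
  refine ⟨0 + (n + 1), balancedIn_of_letterBalanced (σ := compSubst τ 0 (n + 1))
    (R := fun a => compSubst τ 0 n ((r a).head (hrne a)))
    (occursAt_limitWord_substWord hcong hinfinite (n + 1))
    (length_compSubst_pos hcong hquasi (n + 1)) hw (fun b => hn1 _) ?_ hpf (hBpos _).le
    (by positivity) (hcard _) hn2 (hbal _)⟩
  intro j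
  obtain ⟨u, hu⟩ := hrτ (limitWord τ s (0 + n + 1) j) (limitWord τ s (0 + n + 1) (j + 1))
    ⟨j, by simp [OccursAt, List.range_succ]⟩
  change _ <+: substWord (compSubst τ 0 n) (τ (0 + n) (limitWord τ s (0 + n + 1) (j + 1)))
  rw [← hu]
  rw [← List.cons_head_tail (hrne (limitWord τ s (0 + n + 1) j))]
  simp only [substWord, List.cons_append, List.map_cons, List.flatten_cons]
  exact List.prefix_append _ _

end Congenial

/-- Theorem (sufficient conditions for (uniform) factor-balancedness, `S`-adic version):
if a `P`-power-free infinite word `x = x⁽⁰⁾` is generated by a congenial sequence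
`(τ_n, s_n)` satisfying positivity (P), the bounds (of Proposition on `|τ_n|`, `#A_n`
and quasi-uniformity of `τ_{0,n}`), and decisiveness (D), and each `x⁽ⁿ⁾` is
`Bn n`-letter-balanced, then `x` is factor-balanced; if moreover `(Bn n)` is bounded,
then `x` is uniformly factor-balanced. -/
theorem stmt0 {A : ℕ → Type*} [∀ n, Fintype (A n)]
    (τ : ∀ n, A (n+1) → List (A n)) (s : ∀ n, A n)
    (hcong : ∀ n, (τ n (s (n+1))).head? = some (s n))
    (hinfinite : ∀ N : ℕ, ∃ k, N ≤ (compSubst τ 0 k (s (0 + k))).length)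
    (P : ℕ) (hP : 1 ≤ P) (hpf : PowerFree P (limitWord τ s 0))
    (k : ℕ) (hpos : ∀ n, ∀ b : A (n + k), ∀ c : A n, c ∈ compSubst τ n k b)
    (K : ℝ) (hK : 0 < K)
    (hlen : ∀ n, ∀ b : A (n+1), ((τ n b).length : ℝ) ≤ K)
    (hcard : ∀ n, (Fintype.card (A n) : ℝ) ≤ K)
    (hquasi : ∀ n, 1 ≤ n → ∀ a b : A (0 + n),
      ((compSubst τ 0 n a).length : ℝ) ≤ K * ((compSubst τ 0 n b).length : ℝ))
    (hdec : ∀ n, ∃ d, Decisive (τ n) (limitWord τ s (n + 1)) d)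
    (Bn : ℕ → ℝ) (hBpos : ∀ n, 0 < Bn n)
    (hbal : ∀ n, LetterBalanced (Bn n) (limitWord τ s n)) :
    FactorBalanced (limitWord τ s 0) ∧
      ((∃ M : ℝ, ∀ n, Bn n ≤ M) → UniformlyFactorBalanced (limitWord τ s 0)) := by
  have hK1 : 1 ≤ K := by
    have : Nonempty (A 0) := ⟨s 0⟩
    have h : (1 : ℝ) ≤ Fintype.card (A 0) := by exact_mod_cast Fintype.card_pos
    exact h.trans (hcard 0)
  have key := exists_balancedIn_limitWord hcong hinfinite hpf hK1 hlen hcard hquasi hdec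
    hBpos hbal
  constructor
  · intro w
    obtain ⟨n, hn⟩ := key w
    have := hBpos n
    exact ⟨_, by positivity, hn⟩
  · rintro ⟨M, hM⟩
    have hM0 : 0 < M := (hBpos 0).trans_le (hM 0)
    refine ⟨2 * (P * K ^ 3 + 1) + (P * K ^ 3 * (2 + K * M) + 1) + K * M * (P * K ^ 3 + 1),
      by positivity, fun w => ?_⟩
    obtain ⟨n, hn⟩ := key w
    have := hM n
    exact hn.mono (by gcongr)
end

section
/- Let α ∈ (0,1) be irrational and let x ∈ {0,1}^ℕ be the characteristic Sturmian word of slope α, defined by x_n = ⌊(n+2)α⌋ − ⌊(n+1)α⌋ for all n ≥ 0. Then x is uniformly factor-balanced if and only if the partial quotients a_1, a_2, a_3, … of the continued fraction expansion α = [0; a_1, a_2, a_3, …] are bounded. -/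
open scoped Classical

/-- Iterates of the Gauss map starting at `α`; for irrational `α ∈ (0,1)` the `n`-th
partial quotient of `α = [0; a₁, a₂, …]` is `a_{n+1} = ⌊(gaussIter α n)⁻¹⌋`. -/
noncomputable def gaussIter (α : ℝ) : ℕ → ℝ
  | 0 => α
  | n+1 => Int.fract (gaussIter α n)⁻¹

/-- The characteristic Sturmian word of slope `α`: `x n = ⌊(n+2)α⌋ − ⌊(n+1)α⌋`. -/
noncomputable def sturmian (α : ℝ) (n : ℕ) : ℤ :=
  ⌊((n : ℝ) + 2) * α⌋ - ⌊((n : ℝ) + 1) * α⌋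

/-- Denominators of the convergents of `α`, starting with `0, 1, a₁, …`. -/
noncomputable def cfQ (α : ℝ) : ℕ → ℤ
  | 0 => 0
  | 1 => 1
  | n + 2 => ⌊(gaussIter α n)⁻¹⌋ * cfQ α (n + 1) + cfQ α n

/-- Numerators of the convergents of `α`, starting with `1, 0, 1, …`. -/
noncomputable def cfP (α : ℝ) : ℕ → ℤ
  | 0 => 1
  | 1 => 0
  | n + 2 => ⌊(gaussIter α n)⁻¹⌋ * cfP α (n + 1) + cfP α n

/-- The signed approximation error `qₙ α - pₙ`. -/
noncomputable def cfErr (α : ℝ) (n : ℕ) : ℝ := cfQ α n * α - cfP α n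

section ContinuedFraction

variable {α : ℝ}

lemma gaussIter_mem (h0 : 0 < α) (h1 : α < 1) (hirr : Irrational α) (n : ℕ) :
    0 < gaussIter α n ∧ gaussIter α n < 1 ∧ Irrational (gaussIter α n) := by
  induction n with
  | zero => exact ⟨h0, h1, hirr⟩
  | succ n ih =>
    have hi : Irrational (gaussIter α (n + 1)) := by
      have := ih.2.2.inv.sub_intCast ⌊(gaussIter α n)⁻¹⌋
      rwa [Int.self_sub_floor] at this
    refine ⟨?_, Int.fract_lt_one _, hi⟩
    exact lt_of_le_of_ne (Int.fract_nonneg _) hi.ne_zero.symm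

lemma one_le_floor_inv_gaussIter (h0 : 0 < α) (h1 : α < 1) (hirr : Irrational α) (n : ℕ) :
    1 ≤ ⌊(gaussIter α n)⁻¹⌋ := by
  obtain ⟨hp, hl, -⟩ := gaussIter_mem h0 h1 hirr n
  rw [Int.le_floor]
  exact_mod_cast (one_le_inv₀ hp).2 hl.le

lemma cfErr_succ (h0 : 0 < α) (h1 : α < 1) (hirr : Irrational α) (n : ℕ) :
    cfErr α (n + 1) = -gaussIter α n * cfErr α n := by
  induction n with
  | zero => simp [cfErr, cfQ, cfP, gaussIter]
  | succ n ih =>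
    have hp := (gaussIter_mem h0 h1 hirr n).1
    have hrec : cfErr α (n + 2) = ⌊(gaussIter α n)⁻¹⌋ * cfErr α (n + 1) + cfErr α n := by
      simp only [cfErr, cfQ, cfP]; push_cast; ring
    have hn : cfErr α n = -(gaussIter α n)⁻¹ * cfErr α (n + 1) := by
      rw [ih]; field_simp
    rw [hrec, hn]
    simp only [gaussIter, Int.fract]
    ring

lemma cfErr_ne_zero (h0 : 0 < α) (h1 : α < 1) (hirr : Irrational α) (n : ℕ) :
    cfErr α n ≠ 0 := by
  induction n with
  | zero => simp [cfErr, cfQ, cfP]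
  | succ n ih =>
    rw [cfErr_succ h0 h1 hirr]
    exact mul_ne_zero (neg_ne_zero.2 (gaussIter_mem h0 h1 hirr n).1.ne') ih

lemma abs_cfErr_succ_le (h0 : 0 < α) (h1 : α < 1) (hirr : Irrational α) (n : ℕ) :
    |cfErr α (n + 1)| ≤ |cfErr α n| := by
  obtain ⟨hp, hl, -⟩ := gaussIter_mem h0 h1 hirr n
  rw [cfErr_succ h0 h1 hirr, abs_mul, abs_neg, abs_of_pos hp]
  exact mul_le_of_le_one_left (abs_nonneg _) hl.le

lemma cfErr_mul_succ_neg (h0 : 0 < α) (h1 : α < 1) (hirr : Irrational α) (n : ℕ) :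
    cfErr α n * cfErr α (n + 1) < 0 := by
  have hp := (gaussIter_mem h0 h1 hirr n).1
  have hs := mul_self_pos.2 (cfErr_ne_zero h0 h1 hirr n)
  rw [cfErr_succ h0 h1 hirr]
  nlinarith [mul_pos hp hs]

lemma cfQ_cfP_det (α : ℝ) (n : ℕ) :
    cfQ α (n + 1) * cfP α n - cfP α (n + 1) * cfQ α n = (-1) ^ n := by
  induction n with
  | zero => simp [cfQ, cfP]
  | succ n ih =>
    simp only [cfQ, cfP, pow_succ]
    linear_combination -ih

lemma cfQ_nonneg_and_pos (h0 : 0 < α) (h1 : α < 1) (hirr : Irrational α) (n : ℕ) :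
    0 ≤ cfQ α n ∧ 0 < cfQ α (n + 1) := by
  induction n with
  | zero => simp [cfQ]
  | succ n ih =>
    refine ⟨ih.2.le, ?_⟩
    have ha := one_le_floor_inv_gaussIter h0 h1 hirr n
    simp only [cfQ]
    nlinarith [ih.1, ih.2]

lemma cfQ_le_succ (h0 : 0 < α) (h1 : α < 1) (hirr : Irrational α) (n : ℕ) :
    cfQ α n ≤ cfQ α (n + 1) := by
  cases n with
  | zero => simp [cfQ]
  | succ n =>
    have ha := one_le_floor_inv_gaussIter h0 h1 hirr n
    have hq := cfQ_nonneg_and_pos h0 h1 hirr n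
    simp only [cfQ]
    nlinarith [hq.1, hq.2]

lemma le_cfQ (h0 : 0 < α) (h1 : α < 1) (hirr : Irrational α) (n : ℕ) :
    (n : ℤ) ≤ cfQ α (n + 1) := by
  induction n with
  | zero => simp [cfQ]
  | succ n ih =>
    cases n with
    | zero => exact (cfQ_nonneg_and_pos h0 h1 hirr 1).2
    | succ n =>
      have ha := one_le_floor_inv_gaussIter h0 h1 hirr (n + 1)
      have hq := (cfQ_nonneg_and_pos h0 h1 hirr n).2
      have hq' := (cfQ_nonneg_and_pos h0 h1 hirr (n + 1)).2
      rw [cfQ]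
      push_cast at ih ⊢
      nlinarith

/-- Convergents are best approximations of the second kind. -/
lemma abs_cfErr_le (h0 : 0 < α) (h1 : α < 1) (hirr : Irrational α) (n : ℕ) {m : ℤ} (r : ℤ)
    (hm : 0 < m) (hmn : m < cfQ α (n + 1)) : |cfErr α n| ≤ |m * α - r| := by
  have hdet := cfQ_cfP_det α n
  have hsq : ((-1 : ℤ) ^ n) * (-1) ^ n = 1 := by rw [← mul_pow]; simp
  obtain ⟨hq, hq'⟩ := cfQ_nonneg_and_pos h0 h1 hirr n
  obtain ⟨x, y, hx, hy⟩ : ∃ x y : ℤ, m = x * cfQ α n + y * cfQ α (n + 1) ∧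
      r = x * cfP α n + y * cfP α (n + 1) := by
    refine ⟨(-1) ^ n * (cfQ α (n + 1) * r - cfP α (n + 1) * m),
      -(-1) ^ n * (cfQ α n * r - cfP α n * m), ?_, ?_⟩
    · linear_combination (-m) * hsq - (-1) ^ n * m * hdet
    · linear_combination (-r) * hsq - (-1) ^ n * r * hdet
  have hval : (m : ℝ) * α - r = x * cfErr α n + y * cfErr α (n + 1) := by
    rw [hx, hy]; simp only [cfErr]; push_cast; ring
  have hx0 : x ≠ 0 := by
    rintro rfl
    have : 0 < y := by by_contra! h; nlinarith
    nlinarith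
  have hxy : x * y ≤ 0 := by
    by_contra! h
    rcases pos_and_pos_or_neg_and_neg_of_mul_pos h with ⟨hx1, hy1⟩ | ⟨hx1, hy1⟩ <;> nlinarith
  have hneg := cfErr_mul_succ_neg h0 h1 hirr n
  have hx1 : (1 : ℝ) ≤ |(x : ℝ)| := by exact_mod_cast Int.one_le_abs hx0
  have hxyR : (x : ℝ) * y ≤ 0 := by exact_mod_cast hxy
  have hsame : 0 ≤ (x * cfErr α n) * (y * cfErr α (n + 1)) := by
    nlinarith [mul_nonneg_of_nonpos_of_nonpos hxyR hneg.le]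
  rw [hval]
  calc |cfErr α n| ≤ |(x : ℝ)| * |cfErr α n| := le_mul_of_one_le_left (abs_nonneg _) hx1
    _ = |x * cfErr α n| := (abs_mul _ _).symm
    _ ≤ |x * cfErr α n + y * cfErr α (n + 1)| := by
      apply sq_le_sq.1
      nlinarith [sq_nonneg ((y : ℝ) * cfErr α (n + 1))]

lemma one_le_two_mul_cfQ_mul_abs_cfErr (h0 : 0 < α) (h1 : α < 1) (hirr : Irrational α) (n : ℕ) :
    1 ≤ 2 * (cfQ α (n + 1) * |cfErr α n|) := by
  have hdet : (cfQ α (n + 1) : ℝ) * cfP α n - cfP α (n + 1) * cfQ α n = (-1) ^ n := by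
    exact_mod_cast cfQ_cfP_det α n
  obtain ⟨hq, hq'⟩ := cfQ_nonneg_and_pos h0 h1 hirr n
  have hqR : (0 : ℝ) ≤ cfQ α n := by exact_mod_cast hq
  have hqR' : (0 : ℝ) < cfQ α (n + 1) := by exact_mod_cast hq'
  have hle : (cfQ α n : ℝ) ≤ cfQ α (n + 1) := by exact_mod_cast cfQ_le_succ h0 h1 hirr n
  have hval : cfQ α n * cfErr α (n + 1) - cfQ α (n + 1) * cfErr α n = (-1) ^ n := by
    rw [← hdet]; simp only [cfErr]; ring
  have habs : |cfQ α n * cfErr α (n + 1) - cfQ α (n + 1) * cfErr α n| = 1 := by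
    rw [hval]; simp
  have htri := abs_sub (cfQ α n * cfErr α (n + 1)) (cfQ α (n + 1) * cfErr α n)
  rw [habs, abs_mul, abs_mul, abs_of_nonneg hqR, abs_of_pos hqR'] at htri
  have := mul_le_mul hle (abs_cfErr_succ_le h0 h1 hirr n) (abs_nonneg _) hqR'.le
  linarith

/-- An irrational with bounded partial quotients is badly approximable. -/
lemma exists_badly_approximable (h0 : 0 < α) (h1 : α < 1) (hirr : Irrational α) {M : ℤ}
    (hM : ∀ n : ℕ, ⌊(gaussIter α n)⁻¹⌋ ≤ M) :
    ∃ c : ℝ, 0 < c ∧ ∀ m r : ℤ, 0 < m → c ≤ m * |m * α - r| := by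
  have hM1 : 1 ≤ M := (one_le_floor_inv_gaussIter h0 h1 hirr 0).trans (hM 0)
  have hM1R : (1 : ℝ) ≤ M := by exact_mod_cast hM1
  refine ⟨1 / (2 * (M + 1)), by positivity, fun m r hm => ?_⟩
  have hex : ∃ n, m < cfQ α (n + 1) := by
    refine ⟨m.toNat + 1, ?_⟩
    have := le_cfQ h0 h1 hirr (m.toNat + 1)
    push_cast at this
    omega
  obtain ⟨n, hn⟩ : ∃ n, Nat.find hex = n + 1 := by
    refine Nat.exists_eq_succ_of_ne_zero fun h => ?_
    have := Nat.find_spec hex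
    rw [h] at this
    simp [cfQ] at this
    omega
  have hlt : m < cfQ α (n + 2) := by simpa [hn] using Nat.find_spec hex
  have hge : cfQ α (n + 1) ≤ m := by
    have := Nat.find_min hex (m := n) (by omega)
    omega
  have hbest := abs_cfErr_le h0 h1 hirr (n + 1) r hm hlt
  have htwo := one_le_two_mul_cfQ_mul_abs_cfErr h0 h1 hirr (n + 1)
  have hQ : cfQ α (n + 2) ≤ (M + 1) * m := by
    have hq := cfQ_nonneg_and_pos h0 h1 hirr n
    have hle := cfQ_le_succ h0 h1 hirr n
    have ha := hM n
    simp only [cfQ]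
    nlinarith [mul_le_mul_of_nonneg_right ha hq.2.le]
  have hQR : (cfQ α (n + 2) : ℝ) ≤ (M + 1) * m := by exact_mod_cast hQ
  have hmul := mul_le_mul hQR hbest (abs_nonneg _)
    (by have : (0 : ℝ) < m := by exact_mod_cast hm
        positivity)
  rw [div_le_iff₀ (by positivity)]
  linarith

end ContinuedFraction

section Words

variable {A : Type*}

/-- The factor of `x` of length `n` starting at position `i`. -/
def wordAt (x : ℕ → A) (i n : ℕ) : List A := (List.range n).map fun j => x (i + j)

@[simp] lemma length_wordAt (x : ℕ → A) (i n : ℕ) : (wordAt x i n).length = n := by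
  simp [wordAt]

lemma isFactor_wordAt (x : ℕ → A) (i n : ℕ) : IsFactor x (wordAt x i n) :=
  ⟨i, by simp [OccursAt, wordAt]⟩

lemma wordAt_eq_iff (x : ℕ → A) (i k n : ℕ) :
    wordAt x i n = wordAt x k n ↔ ∀ j < n, x (i + j) = x (k + j) := by
  simp [wordAt]

lemma occursAt_iff (x : ℕ → A) (w : List A) (i : ℕ) :
    OccursAt x w i ↔ w = wordAt x i w.length := Iff.rfl

lemma prefix_drop_wordAt_iff (x : ℕ → A) (w : List A) {m N i : ℕ} (hi : i ≤ N) :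
    w <+: (wordAt x m N).drop i ↔ i + w.length ≤ N ∧ OccursAt x w (m + i) := by
  have hdrop : (wordAt x m N).drop i = wordAt x (m + i) (N - i) := by
    apply List.ext_getElem <;> simp [wordAt, add_assoc]
  have htake : ∀ k ≤ N - i, (wordAt x (m + i) (N - i)).take k = wordAt x (m + i) k := by
    intro k hk
    apply List.ext_getElem <;> simp [wordAt, hk]
  rw [hdrop]
  constructor
  · intro h
    have hl := h.length_le
    rw [length_wordAt] at hl
    have := List.prefix_iff_eq_take.1 h
    rw [htake _ hl] at this
    exact ⟨by omega, this⟩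
  · rintro ⟨hl, h⟩
    rw [List.prefix_iff_eq_take, htake _ (by omega)]
    exact h

lemma countOccs_wordAt (x : ℕ → A) (w : List A) (m N : ℕ) :
    countOccs (wordAt x m N) w =
      ((Finset.range (N + 1 - w.length)).filter fun i => OccursAt x w (m + i)).card := by
  unfold countOccs
  congr 1
  ext i
  simp only [Finset.mem_filter, Finset.mem_range, length_wordAt]
  constructor
  · rintro ⟨hi, h⟩
    rw [prefix_drop_wordAt_iff x w (by omega)] at h
    exact ⟨by omega, h.2⟩
  · rintro ⟨hi, h⟩
    exact ⟨by omega, (prefix_drop_wordAt_iff x w (by omega)).2 ⟨by omega, h⟩⟩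

end Words

section Unbalanced

variable {α : ℝ}

/-- The number of integers crossed between `(i+1)α` and `(i+1+q)α`. -/
noncomputable def floorStep (α : ℝ) (q i : ℕ) : ℤ :=
  ⌊((i + q : ℕ) + 1 : ℝ) * α⌋ - ⌊((i : ℝ) + 1) * α⌋

lemma sturmian_add_sub (α : ℝ) (q i : ℕ) :
    sturmian α (i + q) - sturmian α i = floorStep α q (i + 1) - floorStep α q i := by
  have e1 : ((i + 1 + q : ℕ) : ℝ) + 1 = ((i + q : ℕ) : ℝ) + 2 := by push_cast; ring
  have e2 : ((i + 1 : ℕ) : ℝ) + 1 = (i : ℝ) + 2 := by push_cast; ring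
  simp only [sturmian, floorStep, e1, e2]
  ring

lemma exists_floorStep_ne (hirr : Irrational α) {q : ℕ} (hq : 0 < q) (p : ℤ) (N : ℕ) :
    ∃ c, N ≤ c ∧ floorStep α q c ≠ p := by
  by_contra! h
  have hsum : ∀ j : ℕ, ⌊((N + j * q : ℕ) + 1 : ℝ) * α⌋ = ⌊((N : ℝ) + 1) * α⌋ + j * p := by
    intro j
    induction j with
    | zero => simp
    | succ j ih =>
      have := h (N + j * q) (by omega)
      rw [floorStep, ih] at this
      rw [show N + (j + 1) * q = N + j * q + q by ring]
      push_cast at this ⊢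
      linarith
  have hne : (q : ℝ) * α - p ≠ 0 := by
    have := (hirr.natCast_mul hq.ne').sub_intCast p
    exact this.ne_zero
  obtain ⟨j, hj⟩ := exists_nat_gt (1 / |(q : ℝ) * α - p|)
  rw [div_lt_iff₀ (abs_pos.2 hne), ← Nat.abs_cast, ← abs_mul] at hj
  have hs := hsum j
  have hs' : (⌊((N + j * q : ℕ) + 1 : ℝ) * α⌋ : ℝ) = ⌊((N : ℝ) + 1) * α⌋ + j * p := by
    rw [hs]; push_cast; ring
  have a1 := Int.floor_le (((N + j * q : ℕ) + 1 : ℝ) * α)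
  have a2 := Int.lt_floor_add_one (((N + j * q : ℕ) + 1 : ℝ) * α)
  have a3 := Int.floor_le (((N : ℝ) + 1) * α)
  have a4 := Int.lt_floor_add_one (((N : ℝ) + 1) * α)
  rw [hs'] at a1 a2
  push_cast at a1 a2
  have : |(j : ℝ) * (q * α - p)| < 1 := by
    rw [abs_lt]; constructor <;> linarith
  linarith

/-- If `⌊θ + η⌋ ≠ ⌊θ⌋` then an integer separates the two points. -/
lemma exists_int_of_floor_add_ne {θ η : ℝ} (h : ⌊θ + η⌋ ≠ ⌊θ⌋) :
    ∃ r : ℤ, (0 < η ∧ -η ≤ θ - r ∧ θ - r < 0) ∨ (η < 0 ∧ 0 ≤ θ - r ∧ θ - r < -η) := by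
  rcases lt_or_gt_of_ne h with h | h
  · refine ⟨⌊θ⌋, Or.inr ?_⟩
    have := Int.floor_lt.1 h
    have := Int.floor_le θ
    refine ⟨?_, ?_, ?_⟩ <;> linarith
  · refine ⟨⌊θ + η⌋, Or.inl ?_⟩
    have := Int.floor_lt.1 h
    have := Int.floor_le (θ + η)
    refine ⟨?_, ?_, ?_⟩ <;> linarith

lemma floorStep_eq_of_best {q Q : ℕ} {p : ℤ}
    (hbest : ∀ m r : ℤ, 0 < m → m < Q → |q * α - p| ≤ |m * α - r|)
    {c : ℕ} (hc : floorStep α q c ≠ p) {m : ℕ} (hm : 0 < m) (hmQ : m < Q) :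
    floorStep α q (c + m) = p := by
  have key : ∀ i, floorStep α q i ≠ p →
      ⌊((i : ℝ) + 1) * α + (q * α - p)⌋ ≠ ⌊((i : ℝ) + 1) * α⌋ := by
    intro i hi h
    apply hi
    rw [floorStep, ← h, show ((i : ℝ) + 1) * α + (q * α - p) = ((i + q : ℕ) + 1 : ℝ) * α - p by
      push_cast; ring, Int.floor_sub_intCast]
    ring
  by_contra hne
  obtain ⟨r, hr⟩ := exists_int_of_floor_add_ne (key c hc)
  obtain ⟨s, hs⟩ := exists_int_of_floor_add_ne (key (c + m) hne)
  have hb := hbest m (s - r) (by exact_mod_cast hm) (by exact_mod_cast hmQ)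
  push_cast at hb hs
  rcases hr with ⟨e1, e2, e3⟩ | ⟨e1, e2, e3⟩ <;> rcases hs with ⟨d1, d2, d3⟩ | ⟨d1, d2, d3⟩
  · rw [abs_of_pos e1] at hb
    have : |(m : ℝ) * α - (s - r)| < q * α - p := by
      rw [abs_lt]; constructor <;> linarith
    linarith
  · linarith
  · linarith
  · rw [abs_of_neg e1] at hb
    have : |(m : ℝ) * α - (s - r)| < -(q * α - p) := by
      rw [abs_lt]; constructor <;> linarith
    linarith

/-- A long run of `q`-periodicity between two crossings forces an imbalance of `h`. -/
lemma le_of_balanced_of_best (hirr : Irrational α) {C : ℝ}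
    (hbal : ∀ w, BalancedIn C w (sturmian α)) {q Q h : ℕ} {p : ℤ} (hq : 0 < q)
    (hbest : ∀ m r : ℤ, 0 < m → m < Q → |q * α - p| ≤ |m * α - r|)
    (hh : 0 < h) (hQ : 2 * h * q < Q) : (h : ℝ) ≤ C := by
  set x := sturmian α with hx
  obtain ⟨c, hcN, hc⟩ := exists_floorStep_ne hirr hq p (h * q)
  have hper : ∀ i, c < i → i < c + 2 * h * q → x (i + q) = x i := by
    intro i hi hi'
    have e1 := floorStep_eq_of_best hbest hc (m := i - c) (by omega) (by omega)
    have e2 := floorStep_eq_of_best hbest hc (m := i + 1 - c) (by omega) (by omega)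
    rw [show c + (i - c) = i by omega] at e1
    rw [show c + (i + 1 - c) = i + 1 by omega] at e2
    have := sturmian_add_sub α q i
    rw [e1, e2] at this
    rw [hx]; omega
  have hmis : x (c + q) ≠ x c := by
    intro he
    have hhq : 0 < h * q := Nat.mul_pos hh hq
    have e2 := floorStep_eq_of_best hbest hc (m := 1) (by omega) (by
      rw [mul_assoc] at hQ; omega)
    have := sturmian_add_sub α q c
    rw [e2, ← hx, he] at this
    omega
  set n := h * q + q with hn
  set w := wordAt x (c + 1) n with hw
  have hwl : w.length = n := length_wordAt _ _ _
  have hlow : countOccs (wordAt x (c + 1 - h * q) (h * q + n - 1)) w = 0 := by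
    rw [countOccs_wordAt, hwl, Finset.card_eq_zero, Finset.eq_empty_iff_forall_notMem]
    intro i hmem
    obtain ⟨hi, heq⟩ := Finset.mem_filter.1 hmem
    rw [Finset.mem_range] at hi
    rw [occursAt_iff, hwl, hw, wordAt_eq_iff] at heq
    have e1 := heq (h * q - 1 - i) (by omega)
    have e2 := heq (h * q - 1 - i + q) (by omega)
    rw [show c + 1 - h * q + i + (h * q - 1 - i) = c by omega] at e1
    rw [show c + 1 - h * q + i + (h * q - 1 - i + q) = c + q by omega] at e2
    have e3 := hper (c + 1 + (h * q - 1 - i)) (by omega) (by rw [mul_assoc]; omega)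
    apply hmis
    rw [← e1, ← e2, ← e3]
    congr 1
    omega
  have hshift : ∀ j e, j < h → e < n → x (c + 1 + j * q + e) = x (c + 1 + e) := by
    intro j e hj he
    induction j with
    | zero => simp
    | succ j ih =>
      rw [← ih (by omega), show c + 1 + (j + 1) * q + e = c + 1 + j * q + e + q by ring]
      apply hper
      · omega
      · have : (j + 2) * q ≤ h * q := Nat.mul_le_mul_right q (by omega)
        nlinarith
  have hhigh : h ≤ countOccs (wordAt x (c + 1) (h * q + n - 1)) w := by
    rw [countOccs_wordAt, hwl]
    calc h = (Finset.range h).card := (Finset.card_range h).symm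
      _ ≤ _ := by
        apply Finset.card_le_card_of_injOn (fun j => j * q)
        · intro j hj
          have hj : j < h := by simpa using hj
          have : (j + 1) * q ≤ h * q := Nat.mul_le_mul_right q hj
          simp only [Finset.coe_filter, Finset.mem_range, Set.mem_ofPred_eq]
          rw [Nat.add_mul] at this
          refine ⟨by omega, ?_⟩
          rw [occursAt_iff, hwl, hw, wordAt_eq_iff]
          exact fun e he => (hshift j e hj he).symm
        · intro a _ b _ hab
          exact Nat.eq_of_mul_eq_mul_right hq hab
  have := hbal w _ _ (isFactor_wordAt x (c + 1) (h * q + n - 1))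
    (isFactor_wordAt x (c + 1 - h * q) (h * q + n - 1)) (by simp)
  rw [hlow] at this
  have h2 : (h : ℝ) ≤ countOccs (wordAt x (c + 1) (h * q + n - 1)) w := by exact_mod_cast hhigh
  have h3 := le_abs_self
    ((countOccs (wordAt x (c + 1) (h * q + n - 1)) w : ℝ) - ((0 : ℕ) : ℝ))
  push_cast at this h3
  linarith

lemma exists_bound_of_uniformlyFactorBalanced (h0 : 0 < α) (h1 : α < 1) (hirr : Irrational α)
    (hbal : UniformlyFactorBalanced (sturmian α)) :
    ∃ M : ℤ, ∀ n : ℕ, ⌊(gaussIter α n)⁻¹⌋ ≤ M := by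
  obtain ⟨C, hC, hbal⟩ := hbal
  set h : ℕ := ⌊C⌋₊ + 1 with hh
  refine ⟨2 * h, fun n => ?_⟩
  by_contra! hlt
  have hq0 := (cfQ_nonneg_and_pos h0 h1 hirr n).1
  have hq1 := (cfQ_nonneg_and_pos h0 h1 hirr n).2
  have hq2 := (cfQ_nonneg_and_pos h0 h1 hirr (n + 1)).2
  obtain ⟨q, hq⟩ := Int.eq_ofNat_of_zero_le hq1.le
  obtain ⟨Q, hQ⟩ := Int.eq_ofNat_of_zero_le hq2.le
  have hqpos : 0 < q := by omega
  have hqQ : 2 * h * q < Q := by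
    zify
    rw [← hQ, ← hq]
    simp only [cfQ]
    nlinarith
  have hle := le_of_balanced_of_best hirr hbal (q := q) (Q := Q) (p := cfP α (n + 1)) (h := h)
    hqpos (fun m r hm hmQ => by
      have := abs_cfErr_le h0 h1 hirr (n + 1) r hm (by rw [hQ]; exact hmQ)
      rwa [cfErr, hq, Int.cast_natCast] at this) (by omega) hqQ
  have := Nat.lt_floor_add_one C
  rw [hh] at hle
  push_cast at hle
  linarith

end Unbalanced

section Rotation

variable {α : ℝ}

lemma card_Icc_ceil_floor_le {lo hi : ℝ} (h : -1 ≤ hi - lo) :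
    ((Finset.Icc ⌈lo⌉ ⌊hi⌋).card : ℝ) ≤ hi - lo + 1 := by
  rw [Int.card_Icc]
  have h1 := Int.le_ceil lo
  have h2 := Int.floor_le hi
  rcases le_total 0 (⌊hi⌋ + 1 - ⌈lo⌉) with h' | h'
  · have : (((⌊hi⌋ + 1 - ⌈lo⌉).toNat : ℤ) : ℝ) = ((⌊hi⌋ + 1 - ⌈lo⌉ : ℤ) : ℝ) := by
      rw [Int.toNat_of_nonneg h']
    rw [Int.cast_natCast] at this
    rw [this]; push_cast; linarith
  · rw [Int.toNat_of_nonpos h']; push_cast; linarith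

lemma le_card_Icc_ceil_floor (lo hi : ℝ) :
    hi - lo - 1 ≤ ((Finset.Icc ⌈lo⌉ ⌊hi⌋).card : ℝ) := by
  rw [Int.card_Icc]
  have h1 := Int.ceil_lt_add_one lo
  have h2 := Int.lt_floor_add_one hi
  have : ((⌊hi⌋ + 1 - ⌈lo⌉ : ℤ) : ℝ) ≤ (((⌊hi⌋ + 1 - ⌈lo⌉).toNat : ℤ) : ℝ) := by
    exact_mod_cast Int.self_le_toNat _
  push_cast at this
  linarith

/-- The indices `i < L` for which the point `(m+i+1)α` of the rotation visits `[c, d)`. -/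
noncomputable def visits (α c d : ℝ) (m L : ℕ) : Finset ℕ :=
  (Finset.range L).filter fun i =>
    c ≤ Int.fract (((m + i : ℕ) + 1 : ℝ) * α) ∧ Int.fract (((m + i : ℕ) + 1 : ℝ) * α) < d

/-- Visits of a rotation by `α` to an interval of length `kα - r`, with `k` and `r` coprime,
deviate from the expected number by a quantity controlled by `|k| (kα - r)`. -/
lemma abs_card_visits_sub_le {k r : ℤ} (hkr : IsCoprime k r) {c δ : ℝ} (hδ : δ = k * α - r)
    (hpos : 0 < δ) (hc : 0 ≤ c) (hd : c + δ ≤ 1) (m L : ℕ) :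
    |((visits α c (c + δ) m L).card : ℝ) - L * δ| ≤ 2 * (|(k : ℝ)| * δ) + 2 := by
  obtain ⟨u, v, huv⟩ := hkr
  set f : ℕ → ℤ := fun i => k * ⌊((m + i : ℕ) + 1 : ℝ) * α⌋ - r * ((m + i : ℕ) + 1) with hf
  have hdev : ∀ y : ℝ, c ≤ y → y < c + δ → |(k : ℝ) * (y - c)| ≤ |(k : ℝ)| * δ := by
    intro y hy hy'
    rw [abs_mul]
    refine mul_le_mul_of_nonneg_left ?_ (abs_nonneg _)
    rw [abs_of_nonneg] <;> linarith
  have hupper : (visits α c (c + δ) m L).card ≤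
      (Finset.Icc ⌈(m + 1) * δ - k * c - |(k : ℝ)| * δ⌉
        ⌊(m + L) * δ - k * c + |(k : ℝ)| * δ⌋).card := by
    apply Finset.card_le_card_of_injOn f
    · intro i hi
      obtain ⟨hiL, h1, h2⟩ := Finset.mem_filter.1 hi
      rw [Finset.mem_range] at hiL
      have hval : (f i : ℝ) = (m + i + 1) * δ - k * c -
          k * (Int.fract (((m + i : ℕ) + 1 : ℝ) * α) - c) := by
        simp only [hf, hδ, Int.fract]; push_cast; ring
      have hb := abs_le.1 (hdev _ h1 h2)
      have hiR : (i : ℝ) + 1 ≤ L := by exact_mod_cast hiL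
      have hi0 : (0 : ℝ) ≤ i := i.cast_nonneg
      rw [Finset.mem_coe, Finset.mem_Icc, Int.ceil_le, Int.le_floor, hval]
      constructor <;> nlinarith
    · intro i hi j hj hij
      obtain ⟨-, h1, h2⟩ := Finset.mem_filter.1 hi
      obtain ⟨-, h3, h4⟩ := Finset.mem_filter.1 hj
      simp only [hf] at hij
      set z := ⌊((m + i : ℕ) + 1 : ℝ) * α⌋ with hz
      set z' := ⌊((m + j : ℕ) + 1 : ℝ) * α⌋ with hz'
      have hij' : k * (z - z') = r * ((i : ℤ) - j) := by
        push_cast at hij; linear_combination hij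
      set e := u * ((i : ℤ) - j) + v * (z - z') with he
      have hke : k * e = (i : ℤ) - j := by
        linear_combination ((i : ℤ) - j) * huv + v * hij' + k * he
      have hre : r * e = z - z' := by
        linear_combination (z - z') * huv - u * hij' + r * he
      have hkeR : (k : ℝ) * e = i - j := by exact_mod_cast hke
      have hreR : (r : ℝ) * e = z - z' := by exact_mod_cast hre
      have hdiff : Int.fract (((m + i : ℕ) + 1 : ℝ) * α) - Int.fract (((m + j : ℕ) + 1 : ℝ) * α)
          = e * δ := by
        simp only [Int.fract, ← hz, ← hz', hδ]
        push_cast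
        linear_combination (-α) * hkeR + hreR
      have he0 : e = 0 := by
        have e1 : (e : ℝ) * δ < 1 * δ := by linarith
        have e2 : (-1 : ℝ) * δ < e * δ := by linarith
        have e3 := lt_of_mul_lt_mul_right e1 hpos.le
        have e4 := lt_of_mul_lt_mul_right e2 hpos.le
        have e5 : e < 1 := by exact_mod_cast e3
        have e6 : -1 < e := by exact_mod_cast e4
        omega
      rw [he0] at hke
      omega
  have hlower : (Finset.Icc ⌈(m + 1) * δ - k * c + |(k : ℝ)| * δ⌉
        ⌊(m + L) * δ - k * c - |(k : ℝ)| * δ⌋).card ≤ (visits α c (c + δ) m L).card := by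
    apply Finset.card_le_card_of_surjOn f
    intro l hl
    rw [Finset.mem_coe, Finset.mem_Icc, Int.ceil_le, Int.le_floor] at hl
    set y₀ : ℝ := ((-v * l : ℤ) : ℝ) * α - ((u * l : ℤ) : ℝ) with hy₀
    set e : ℤ := -⌊(y₀ - c) / δ⌋ with he
    set I : ℤ := -v * l + k * e with hI
    set Z : ℤ := u * l + r * e with hZ
    have hy : (I : ℝ) * α - Z = y₀ + e * δ := by
      simp only [hI, hZ, hy₀, hδ]; push_cast; ring
    have hfl : k * Z - r * I = l := by
      simp only [hI, hZ]; linear_combination l * huv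
    have hflR : (k : ℝ) * Z - r * I = l := by exact_mod_cast hfl
    have hy1 : c ≤ I * α - Z := by
      have := (le_div_iff₀ hpos).1 (Int.floor_le ((y₀ - c) / δ))
      rw [hy, he]; push_cast; linarith
    have hy2 : I * α - Z < c + δ := by
      have := (div_lt_iff₀ hpos).1 (Int.lt_floor_add_one ((y₀ - c) / δ))
      rw [hy, he]; push_cast; linarith
    have hb := abs_le.1 (hdev _ hy1 hy2)
    have hId : (I : ℝ) * δ = l + k * c + k * (I * α - Z - c) := by
      rw [hδ]; linear_combination hflR
    have hI1 : (m : ℤ) + 1 ≤ I := by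
      have : ((m : ℝ) + 1) * δ ≤ I * δ := by linarith [hl.1]
      exact_mod_cast le_of_mul_le_mul_right this hpos
    have hI2 : I ≤ (m : ℤ) + L := by
      have : (I : ℝ) * δ ≤ (m + L) * δ := by linarith [hl.2]
      exact_mod_cast le_of_mul_le_mul_right this hpos
    have hcast : (((m + (I - 1 - m).toNat : ℕ) : ℝ) + 1) = I := by
      have : ((m + (I - 1 - m).toNat : ℕ) : ℤ) + 1 = I := by push_cast; omega
      exact_mod_cast this
    have hfloor : ⌊(I : ℝ) * α⌋ = Z := by
      rw [Int.floor_eq_iff]; constructor <;> linarith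
    refine ⟨(I - 1 - m).toNat, ?_, ?_⟩
    · rw [Finset.mem_coe, visits, Finset.mem_filter, Finset.mem_range, hcast, Int.fract, hfloor]
      exact ⟨by omega, hy1, hy2⟩
    · simp only [hf, hcast, hfloor]
      rw [← hfl]
      congr 2
      push_cast
      omega
  have hkδ : 0 ≤ |(k : ℝ)| * δ := by positivity
  have hL : (0 : ℝ) ≤ L * δ := by positivity
  have hu := (Nat.cast_le (α := ℝ)).2 hupper
  have hl := (Nat.cast_le (α := ℝ)).2 hlower
  have hu' := hu.trans (card_Icc_ceil_floor_le (by linarith))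
  have hl' := (le_card_Icc_ceil_floor _ _).trans hl
  rw [abs_le]
  constructor <;> linarith

/-- For badly approximable `α`, an interval missing `-jα` modulo one for `0 ≤ j ≤ n` is short. -/
lemma length_mul_le_of_no_point {κ : ℝ} (hκ : ∀ m r : ℤ, 0 < m → κ ≤ m * |m * α - r|)
    {c d : ℝ} {n : ℕ}
    (hno : ∀ j z : ℤ, 0 ≤ j → j ≤ n → ¬(c < z - j * α ∧ z - j * α < d)) (hcd : c ≤ d) :
    (d - c) * n * κ ≤ 3 := by
  obtain ⟨ρ, hρ, hden⟩ := Real.exists_rat_abs_sub_le_and_den_le α (n := n + 1) (by omega)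
  set q : ℕ := ρ.den with hq
  set P : ℤ := ρ.num with hP
  have hq0 : (0 : ℝ) < q := by exact_mod_cast ρ.den_pos
  have hρv : (ρ : ℝ) = P / q := by exact_mod_cast (Rat.num_div_den ρ).symm
  have herr : |(q : ℝ) * α - P| * (n + 1) ≤ 1 := by
    have : (q : ℝ) * α - P = (α - ρ) * q := by rw [hρv]; field_simp
    rw [this, abs_mul, abs_of_pos hq0]
    rw [le_div_iff₀ (by positivity)] at hρ
    push_cast at hρ
    nlinarith [mul_nonneg (abs_nonneg (α - ρ)) hq0.le]
  have hqn : κ * (n + 1) ≤ q := by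
    have := hκ q P (by exact_mod_cast ρ.den_pos)
    rw [Int.cast_natCast] at this
    have hn : (0 : ℝ) < n + 1 := by positivity
    nlinarith [mul_le_mul_of_nonneg_right this hn.le]
  have hδq : (d - c) * q ≤ 3 := by
    by_contra! hlt
    obtain ⟨u, v, huv⟩ : IsCoprime P (q : ℤ) := by
      rw [Int.isCoprime_iff_gcd_eq_one]
      simpa [Int.gcd, hP, hq] using ρ.reduced
    set e : ℤ := ⌊q * c + 1⌋ + 1 with he
    have he1 : q * c + 1 < e := by rw [he]; push_cast; exact Int.lt_floor_add_one _
    have he2 : (e : ℝ) ≤ q * c + 2 := by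
      rw [he]; push_cast; linarith [Int.floor_le ((q : ℝ) * c + 1)]
    set j : ℤ := (-(u * e)) % q with hj
    set z : ℤ := v * e - (-(u * e)) / q * P with hz
    have hqz : (0 : ℤ) < q := by exact_mod_cast ρ.den_pos
    have hj0 : 0 ≤ j := Int.emod_nonneg _ hqz.ne'
    have hjq : j < q := Int.emod_lt_of_pos _ hqz
    have hjn : j ≤ n := by omega
    have heq : q * z - j * P = e := by
      have := Int.emod_add_mul_ediv (-(u * e)) q
      rw [← hj] at this
      rw [hz]
      linear_combination e * huv - P * this
    have heqR : (q : ℝ) * z - j * P = e := by exact_mod_cast heq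
    have hjnR : (j : ℝ) ≤ n := by exact_mod_cast hjn
    have hj0R : (0 : ℝ) ≤ j := by exact_mod_cast hj0
    have hpt : q * ((z : ℝ) - j * α) = e - j * (q * α - P) := by linear_combination heqR
    have hje : |(j : ℝ) * (q * α - P)| ≤ 1 := by
      rw [abs_mul, abs_of_nonneg hj0R]
      nlinarith [abs_nonneg ((q : ℝ) * α - P),
        mul_le_mul_of_nonneg_right hjnR (abs_nonneg ((q : ℝ) * α - P))]
    have hje' := abs_le.1 hje
    refine hno j z hj0 hjn ⟨?_, ?_⟩
    · refine lt_of_mul_lt_mul_left ?_ hq0.le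
      rw [hpt]; linarith
    · refine lt_of_mul_lt_mul_left ?_ hq0.le
      rw [hpt]; nlinarith
  by_cases hκ0 : 0 ≤ κ
  · have : κ * n ≤ q := by linarith
    nlinarith [mul_le_mul_of_nonneg_left this (sub_nonneg.2 hcd)]
  · push Not at hκ0
    have : 0 ≤ (d - c) * n := mul_nonneg (sub_nonneg.2 hcd) n.cast_nonneg
    nlinarith

/-- Occurrences of a factor of a Sturmian word are visits to an interval whose endpoints
are consecutive among the points `-jα` modulo one. -/
lemma exists_interval_of_occursAt {w : List ℤ} {i₀ : ℕ} (hw : OccursAt (sturmian α) w i₀) :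
    ∃ (c δ : ℝ) (k r : ℤ), IsCoprime k r ∧ δ = k * α - r ∧ 0 < δ ∧ 0 ≤ c ∧ c + δ ≤ 1 ∧
      |k| ≤ w.length ∧
      (∀ j z : ℤ, 0 ≤ j → j ≤ w.length → ¬(c < z - j * α ∧ z - j * α < c + δ)) ∧
      ∀ i : ℕ, OccursAt (sturmian α) w i ↔
        c ≤ Int.fract (((i : ℝ) + 1) * α) ∧ Int.fract (((i : ℝ) + 1) * α) < c + δ := by
  set n := w.length with hn
  set t : ℕ → ℝ := fun i => Int.fract (((i : ℝ) + 1) * α) with ht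
  set s : ℕ → ℤ := fun j => ⌊t i₀ + j * α⌋ with hs
  have hx : ∀ i j, sturmian α (i + j) = ⌊t i + (j + 1 : ℕ) * α⌋ - ⌊t i + j * α⌋ := by
    intro i j
    have e1 : t i + (j + 1 : ℕ) * α = (((i + j : ℕ) : ℝ) + 2) * α - ⌊((i : ℝ) + 1) * α⌋ := by
      simp only [ht, Int.fract]; push_cast; ring
    have e2 : t i + j * α = (((i + j : ℕ) : ℝ) + 1) * α - ⌊((i : ℝ) + 1) * α⌋ := by
      simp only [ht, Int.fract]; push_cast; ring
    rw [e1, e2, Int.floor_sub_intCast, Int.floor_sub_intCast, sturmian]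
    ring
  have hocc : ∀ i, OccursAt (sturmian α) w i ↔ ∀ j ≤ n, ⌊t i + j * α⌋ = s j := by
    intro i
    have hw' : w = wordAt (sturmian α) i₀ n := hw
    rw [occursAt_iff, ← hn, hw', wordAt_eq_iff]
    constructor
    · intro h j hj
      induction j with
      | zero => simp [hs, ht]
      | succ j ih =>
        have := h j (by omega)
        rw [hx, hx, ih (by omega)] at this
        simp only [hs] at this ⊢
        linarith
    · intro h j hj
      rw [hx, hx, h j (by omega), h (j + 1) (by omega)]
  obtain ⟨a, ha, hamax⟩ := Finset.exists_max_image (Finset.range (n + 1))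
    (fun j => (s j : ℝ) - j * α) ⟨0, by simp⟩
  obtain ⟨b, hb, hbmin⟩ := Finset.exists_min_image (Finset.range (n + 1))
    (fun j => (s j : ℝ) - j * α) ⟨0, by simp⟩
  simp only [Finset.mem_range, Nat.lt_succ_iff] at ha hb hamax hbmin
  have hs0 : s 0 = 0 := by simp [hs, ht]
  have hiff : ∀ i, OccursAt (sturmian α) w i ↔
      (s a : ℝ) - a * α ≤ t i ∧ t i < s b + 1 - b * α := by
    intro i
    rw [hocc]
    constructor
    · intro h
      have h1 := Int.floor_eq_iff.1 (h a ha)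
      have h2 := Int.floor_eq_iff.1 (h b hb)
      constructor <;> linarith [h1.1, h2.2]
    · rintro ⟨h1, h2⟩ j hj
      have h3 := hamax j hj
      have h4 := hbmin j hj
      rw [Int.floor_eq_iff]
      constructor <;> linarith
  have hi₀ := (hiff i₀).1 hw
  set δ : ℝ := s b + 1 - b * α - (s a - a * α) with hδ
  have hcδ : (s a : ℝ) - a * α + δ = s b + 1 - b * α := by rw [hδ]; ring
  have hpos : 0 < δ := by rw [hδ]; linarith [hi₀.1, hi₀.2]
  have hno : ∀ j z : ℤ, 0 ≤ j → j ≤ n →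
      ¬((s a : ℝ) - a * α < z - j * α ∧ z - j * α < s a - a * α + δ) := by
    rintro j z hj0 hjn ⟨h1, h2⟩
    lift j to ℕ using hj0
    have hjn' : j ≤ n := by exact_mod_cast hjn
    rw [Int.cast_natCast] at h1 h2
    have h3 := hamax j hjn'
    have h4 := hbmin j hjn'
    have h5 : (s j : ℝ) < z := by linarith
    have h6 : (z : ℝ) < s j + 1 := by linarith
    have h7 : s j < z := by exact_mod_cast h5
    have h8 : z < s j + 1 := by exact_mod_cast h6
    omega
  have hδkr : δ = ((a - b : ℤ) : ℝ) * α - ((s a - s b - 1 : ℤ) : ℝ) := by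
    rw [hδ]; push_cast; ring
  refine ⟨s a - a * α, δ, a - b, s a - s b - 1, ?_, hδkr, hpos, ?_, ?_, ?_, hno, ?_⟩
  · rw [Int.isCoprime_iff_gcd_eq_one]
    obtain ⟨k', hk'⟩ := Int.gcd_dvd_left (a - b : ℤ) (s a - s b - 1)
    obtain ⟨r', hr'⟩ := Int.gcd_dvd_right (a - b : ℤ) (s a - s b - 1)
    generalize Int.gcd (a - b : ℤ) (s a - s b - 1) = g at hk' hr' ⊢
    have hg : δ = g * (k' * α - r') := by
      rw [hδkr, hk', hr']; push_cast; ring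
    by_contra hg1
    have hg0 : g ≠ 0 := by
      rintro rfl
      rw [hg] at hpos
      simp at hpos
    have hg2 : 2 ≤ g := by omega
    have hg2R : (2 : ℝ) ≤ g := by exact_mod_cast hg2
    have hg2Z : (2 : ℤ) ≤ g := by exact_mod_cast hg2
    have hε : 0 < (k' : ℝ) * α - r' := by
      rw [hg] at hpos
      exact pos_of_mul_pos_right hpos (by positivity)
    refine hno (a - k') (s a - r') ?_ ?_ ⟨?_, ?_⟩
    · rcases le_total 0 k' with h | h
      · nlinarith
      · omega
    · rcases le_total 0 k' with h | h
      · omega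
      · nlinarith
    · push_cast; linarith
    · push_cast; nlinarith
  · have := hamax 0 (by omega)
    rw [hs0] at this
    simpa using this
  · have := hbmin 0 (by omega)
    rw [hs0] at this
    rw [hcδ]
    simp at this
    linarith
  · rw [abs_le]; omega
  · intro i
    rw [hcδ]
    exact hiff i

lemma uniformlyFactorBalanced_of_badly_approximable {κ : ℝ} (hκ0 : 0 < κ)
    (hκ : ∀ m r : ℤ, 0 < m → κ ≤ m * |m * α - r|) :
    UniformlyFactorBalanced (sturmian α) := by
  refine ⟨4 * (3 / κ) + 4, by positivity, ?_⟩
  rintro w u v ⟨m, hm⟩ ⟨m', hm'⟩ hlen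
  by_cases hw : ∃ i₀, OccursAt (sturmian α) w i₀
  · obtain ⟨i₀, hi₀⟩ := hw
    obtain ⟨c, δ, k, r, hkr, hδ, hpos, hc, hd, hk, hno, hocc⟩ := exists_interval_of_occursAt hi₀
    have hgap := length_mul_le_of_no_point hκ hno (by linarith)
    have hkR : |(k : ℝ)| ≤ w.length := by exact_mod_cast hk
    have hkδ : |(k : ℝ)| * δ ≤ 3 / κ := by
      rw [le_div_iff₀ hκ0]
      rw [add_sub_cancel_left] at hgap
      have := mul_le_mul_of_nonneg_right hkR (mul_pos hpos hκ0).le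
      linarith
    have hcount : ∀ m N, countOccs (wordAt (sturmian α) m N) w =
        (visits α c (c + δ) m (N + 1 - w.length)).card := by
      intro m N
      rw [countOccs_wordAt, visits]
      congr 1
      ext i
      simp only [Finset.mem_filter, hocc]
    rw [show u = wordAt (sturmian α) m u.length from hm,
      show v = wordAt (sturmian α) m' u.length from hlen ▸ hm', hcount, hcount]
    have h1 := abs_le.1 (abs_card_visits_sub_le hkr hδ hpos hc hd m (u.length + 1 - w.length))
    have h2 := abs_le.1 (abs_card_visits_sub_le hkr hδ hpos hc hd m' (u.length + 1 - w.length))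
    rw [abs_le]
    constructor <;> linarith
  · push Not at hw
    have hcount : ∀ m N, countOccs (wordAt (sturmian α) m N) w = 0 := by
      intro m N
      simp [countOccs_wordAt, hw]
    rw [show u = wordAt (sturmian α) m u.length from hm,
      show v = wordAt (sturmian α) m' v.length from hm', hcount, hcount]
    simp
    positivity

end Rotation

/-- Theorem: the characteristic Sturmian word of irrational slope `α ∈ (0,1)` is
uniformly factor-balanced if and only if the partial quotients of the continued
fraction of `α` are bounded. -/
theorem stmt3 (α : ℝ) (h0 : 0 < α) (h1 : α < 1) (hirr : Irrational α) :
    UniformlyFactorBalanced (sturmian α) ↔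
      ∃ M : ℤ, ∀ n : ℕ, ⌊(gaussIter α n)⁻¹⌋ ≤ M := by
  constructor
  · exact exists_bound_of_uniformlyFactorBalanced h0 h1 hirr
  · rintro ⟨M, hM⟩
    obtain ⟨κ, hκ0, hκ⟩ := exists_badly_approximable h0 h1 hirr hM
    exact uniformlyFactorBalanced_of_badly_approximable hκ0 hκ
end
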